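/- Let f be the free holomorphic function with scalar coefficients a = (a_α)_{α∈𝔽ₙ⁺} on the unit ball (γ = 1), and suppose f_K(X) + f_K(X)* ≥ 0 for every complex Hilbert space K and every X ∈ [B(K)ⁿ]₁. Then there exists a linear functional μ on the C*-subalgebra C*(R₁,…,Rₙ) of B(F²(Hₙ)) generated by the right creation operators R₁,…,Rₙ and the identity, which is positive (μ(T) is a nonnegative real number whenever T ∈ C*(R₁,…,Rₙ) is a positive operator), such that μ(I) = Re(a_{g₀}) and a_α = 2 μ(R_{α̃}*) for every α with |α| ≥ 1, where α̃ denotes the reverse of α. -/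

import Mathlib

open scoped ENNReal ComplexOrder
open Filter ContinuousLinearMap

noncomputable section

abbrev Word (n : ℕ) := FreeMonoid (Fin n)

/-- The word determined by a tuple of letters. -/
def word {n k : ℕ} (f : Fin k → Fin n) : Word n :=
  FreeMonoid.ofList (List.ofFn f)

/-- The length of a word. -/
def wordLen {n : ℕ} (α : Word n) : ℕ := (FreeMonoid.toList α).length

/-- The product `X_α = X_{i₁} ⋯ X_{i_k}` for `α = g_{i₁} ⋯ g_{i_k}`. -/
def wordProd {n : ℕ} {K : Type} [NormedAddCommGroup K] [InnerProductSpace ℂ K]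
    (X : Fin n → K →L[ℂ] K) (α : Word n) : K →L[ℂ] K :=
  ((FreeMonoid.toList α).map X).prod

/-- `Σ_{|α| = k} a_α X_α`. -/
def truncSum {n : ℕ} {K : Type} [NormedAddCommGroup K] [InnerProductSpace ℂ K]
    (a : Word n → ℂ) (X : Fin n → K →L[ℂ] K) (k : ℕ) : K →L[ℂ] K :=
  ∑ f : Fin k → Fin n, a (word f) • wordProd X (word f)

/-- `Σ_{|α| = k} b_α X_α*`. -/
def truncSumAdj {n : ℕ} {K : Type} [NormedAddCommGroup K] [InnerProductSpace ℂ K]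
    [CompleteSpace K] (b : Word n → ℂ) (X : Fin n → K →L[ℂ] K) (k : ℕ) : K →L[ℂ] K :=
  ∑ f : Fin k → Fin n, b (word f) • adjoint (wordProd X (word f))

/-- The free holomorphic function `f(X) = Σ_k Σ_{|α| = k} a_α X_α`. -/
def holOp {n : ℕ} {K : Type} [NormedAddCommGroup K] [InnerProductSpace ℂ K]
    (a : Word n → ℂ) (X : Fin n → K →L[ℂ] K) : K →L[ℂ] K :=
  ∑' k : ℕ, truncSum a X k

/-- The free pluriharmonic function
`u(X) = Σ_{k ≥ 1} Σ_{|α| = k} b_α X_α* + a_{g₀} I + Σ_{k ≥ 1} Σ_{|α| = k} a_α X_α`. -/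
def phOp {n : ℕ} {K : Type} [NormedAddCommGroup K] [InnerProductSpace ℂ K]
    [CompleteSpace K] (a b : Word n → ℂ) (X : Fin n → K →L[ℂ] K) : K →L[ℂ] K :=
  (∑' k : ℕ, truncSumAdj b X (k + 1)) + a 1 • (1 : K →L[ℂ] K)
    + ∑' k : ℕ, truncSum a X (k + 1)

/-- Membership in the open noncommutative ball of radius `γ`. -/
def inBall {n : ℕ} {K : Type} [NormedAddCommGroup K] [InnerProductSpace ℂ K]
    [CompleteSpace K] (γ : ℝ) (X : Fin n → K →L[ℂ] K) : Prop :=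
  ‖∑ i, X i * adjoint (X i)‖ < γ ^ 2

/-- Membership in the closed noncommutative ball of radius `γ`. -/
def inClosedBall {n : ℕ} {K : Type} [NormedAddCommGroup K] [InnerProductSpace ℂ K]
    [CompleteSpace K] (γ : ℝ) (X : Fin n → K →L[ℂ] K) : Prop :=
  ‖∑ i, X i * adjoint (X i)‖ ≤ γ ^ 2

/-- The radius-`γ` condition `limsup_k (Σ_{|α|=k} |a_α|²)^{1/(2k)} ≤ 1/γ`. -/
def radCond {n : ℕ} (γ : ℝ) (a : Word n → ℂ) : Prop :=
  Filter.limsup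
    (fun k : ℕ =>
      (∑ f : Fin k → Fin n, (‖a (word f)‖₊ : ℝ≥0∞) ^ 2) ^ ((1 : ℝ) / (2 * (k : ℝ))))
    Filter.atTop ≤ ENNReal.ofReal (1 / γ)

/-- The coefficients of the radial function: `α ↦ r^{|α|} a_α`. -/
def scaleCoef {n : ℕ} (r : ℝ) (a : Word n → ℂ) : Word n → ℂ :=
  fun α => ((r : ℂ) ^ wordLen α) * a α

/-- Positivity of the free pluriharmonic function with coefficients `(a, b)` on the
noncommutative ball of radius `γ` of every complex Hilbert space. -/
def posPH {n : ℕ} (γ : ℝ) (a b : Word n → ℂ) : Prop :=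
  ∀ (K : Type) [NormedAddCommGroup K] [InnerProductSpace ℂ K] [CompleteSpace K],
    ∀ X : Fin n → K →L[ℂ] K, inBall γ X → (phOp a b X).IsPositive


section helpers

set_option linter.unusedSectionVars false

variable {F : Type} [NormedAddCommGroup F] [InnerProductSpace ℂ F] [CompleteSpace F]

lemma hb_ext {ι : Type} (b : HilbertBasis ι ℂ F) {S T : F →L[ℂ] F}
    (h : ∀ i, S (b i) = T (b i)) : S = T := by
  have hd : Dense (Submodule.span ℂ (Set.range b) : Set F) := by
    exact (Submodule.dense_iff_topologicalClosure_eq_top).2 b.dense_span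
  refine ContinuousLinearMap.ext_on hd ?_
  rintro _ ⟨i, rfl⟩
  exact h i

lemma hb_zero {ι : Type} (b : HilbertBasis ι ℂ F) {x : F}
    (h : ∀ i, inner ℂ (b i) x = 0) : x = 0 := by
  have : b.repr x = 0 := by
    ext i
    rw [b.repr_apply_apply, h i]; rfl
  simpa using this

lemma hb_isom {ι : Type} (b : HilbertBasis ι ℂ F) {v : ι → F} (hv : Orthonormal ℂ v) :
    ∃ V : F →L[ℂ] F, (∀ i, V (b i) = v i) ∧ ∀ x y, inner ℂ (V x) (V y) = inner ℂ x y := by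
  classical
  let V := hv.orthogonalFamily.linearIsometry.comp b.repr.toLinearIsometry
  refine ⟨V.toContinuousLinearMap, fun i => ?_, fun x y => V.inner_map_map x y⟩
  simp [V, b.repr_self]

lemma wordProd_one {n : ℕ} (X : Fin n → F →L[ℂ] F) : wordProd X 1 = 1 := by
  simp [wordProd]

lemma wordProd_of_mul {n : ℕ} (X : Fin n → F →L[ℂ] F) (i : Fin n) (α : Word n) :
    wordProd X (FreeMonoid.of i * α) = X i * wordProd X α := by
  simp [wordProd]

/-- reversal of words -/
def rev {n : ℕ} (α : Word n) : Word n := FreeMonoid.ofList (FreeMonoid.toList α).reverse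

lemma rev_of_mul {n : ℕ} (i : Fin n) (α : Word n) :
    rev (FreeMonoid.of i * α) = rev α * FreeMonoid.of i := by
  simp [rev, FreeMonoid.ofList_append]

lemma rev_rev {n : ℕ} (α : Word n) : rev (rev α) = α := by
  simp [rev]

lemma rev_one {n : ℕ} : rev (1 : Word n) = 1 := rfl

lemma of_mul_inj {n : ℕ} {i j : Fin n} {α β : Word n} :
    FreeMonoid.of i * α = FreeMonoid.of j * β ↔ i = j ∧ α = β :=
  List.cons_eq_cons

lemma of_mul_ne_one {n : ℕ} (i : Fin n) (α : Word n) : FreeMonoid.of i * α ≠ 1 :=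
  List.cons_ne_nil _ _

lemma exists_lim {E : Type} [AddCommGroup E] [Module ℂ E] (m : ℕ → E →ₗ[ℂ] ℂ)
    (hb : ∀ T, ∃ C : ℝ, ∀ k, ‖m k T‖ ≤ C) :
    ∃ μ : E →ₗ[ℂ] ℂ, ∀ T, Tendsto (fun k => m k T) (hyperfilter ℕ : Filter ℕ) (nhds (μ T)) := by
  have h : ∀ T, ∃ z : ℂ, Tendsto (fun k => m k T) (hyperfilter ℕ : Filter ℕ) (nhds z) := by
    intro T
    obtain ⟨C, hC⟩ := hb T
    obtain ⟨z, -, hz⟩ := (isCompact_closedBall (0 : ℂ) C).ultrafilter_le_nhds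
      ((hyperfilter ℕ).map (fun k => m k T)) (by
        rw [le_principal_iff]
        exact Filter.mem_map.2 (Filter.univ_mem' fun k => by simpa using hC k))
    exact ⟨z, hz⟩
  choose μ hμ using h
  refine ⟨{ toFun := μ, map_add' := fun S T => ?_, map_smul' := fun c T => ?_ }, hμ⟩
  · refine tendsto_nhds_unique (hμ (S + T)) ?_
    simpa using (hμ S).add (hμ T)
  · refine tendsto_nhds_unique (hμ (c • T)) ?_
    simpa using (hμ T).const_mul c

lemma outer {n : ℕ} (e : HilbertBasis (Word n) ℂ F)
    (R : Fin n → F →L[ℂ] F)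
    (hR : ∀ (i : Fin n) (α : Word n), R i (e α) = e (α * FreeMonoid.of i))
    (L : Fin n → F →L[ℂ] F)
    (hL : ∀ (i : Fin n) (α : Word n), L i (e α) = e (FreeMonoid.of i * α))
    (hLL : ∀ i j x y, inner ℂ (L i x) (L j y) = if i = j then inner ℂ x y else 0)
    (A : F →L[ℂ] F) (hA : IsStrictlyPositive A)
    (hT : ∀ i j x y, inner ℂ (L i x) (A (L j y)) = if i = j then inner ℂ x (A y) else 0) :
    ∃ ξ : F, ∀ γ, inner ℂ (wordProd R γ ξ) ξ = inner ℂ (e γ) (A (e 1)) := by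
  classical
  have hA0 : 0 ≤ A := hA.nonneg
  obtain ⟨S, hSA, hSS⟩ : ∃ S : F →L[ℂ] F, S * S = A ∧ IsSelfAdjoint S :=
    ⟨CFC.sqrt A, CFC.sqrt_mul_sqrt_self A hA0, (CFC.sqrt_nonneg A).isSelfAdjoint⟩
  have hsymm : ∀ x y, inner ℂ (S x) y = inner ℂ x (S y) := by
    intro x y
    conv_rhs => rw [← hSS.adjoint_eq]
    rw [adjoint_inner_right]
  have hAS : ∀ x, A x = S (S x) := fun x => by rw [← hSA]; rfl
  have hAsymm : ∀ x y, inner ℂ (A x) y = inner ℂ x (A y) := by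
    intro x y; rw [hAS, hAS, hsymm, hsymm]
  obtain ⟨B, hAB, hBA⟩ := isUnit_iff_exists.1 hA.isUnit
  have hAB' : ∀ x, A (B x) = x := fun x => by
    rw [← mul_apply_eq_comp, hAB]; rfl
  have hSB : ∀ x, S (S (B x)) = x := fun x => by rw [← hAS, hAB']
  have hBS : ∀ x, B (S (S x)) = x := fun x => by
    rw [← hAS, ← mul_apply_eq_comp, hBA]; rfl
  -- wandering vector
  have he1 : ‖e (1 : Word n)‖ = 1 := e.orthonormal.1 1
  set w0 := B (e 1) with hw0
  have hSw0 : S w0 ≠ 0 := by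
    intro h
    have : e (1 : Word n) = 0 := by rw [← hSB (e 1), ← hw0, h, map_zero]
    rw [this] at he1; simp at he1
  set c : ℂ := ((‖S w0‖⁻¹ : ℝ) : ℂ) with hc
  have hc0 : c ≠ 0 := by
    rw [hc]; exact_mod_cast inv_ne_zero (norm_ne_zero_iff.2 hSw0)
  set w := c • w0 with hw
  have hAw : A w = c • e 1 := by rw [hw, map_smul, hAB']
  have hSw : ‖S w‖ = 1 := by
    rw [hw, map_smul, norm_smul, hc, Complex.norm_real, norm_inv, norm_norm,
      inv_mul_cancel₀ (norm_ne_zero_iff.2 hSw0)]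
  have hLe1 : ∀ i x, inner ℂ (e 1) (L i x) = 0 := by
    intro i x
    rw [← adjoint_inner_left]
    suffices h : adjoint (L i) (e 1) = 0 by rw [h, inner_zero_left]
    refine hb_zero e fun α => ?_
    rw [adjoint_inner_right, hL]
    exact e.orthonormal.2 (of_mul_ne_one i α)
  have horth : ∀ α β : Word n, inner ℂ (wordProd L α w) (A (wordProd L β w))
      = if α = β then 1 else 0 := by
    intro α
    induction α using FreeMonoid.inductionOn' with
    | one =>
      intro β
      induction β using FreeMonoid.inductionOn' with
      | one =>
        rw [wordProd_one, if_pos rfl]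
        simp only [one_apply_eq_self]
        rw [hAS, ← hsymm, inner_self_eq_norm_sq_to_K, hSw]; simp
      | of_mul j β _ =>
        rw [wordProd_one, wordProd_of_mul, ← hAsymm, if_neg (of_mul_ne_one j β).symm]
        simp only [one_apply_eq_self, mul_apply_eq_comp]
        rw [hAw, inner_smul_left, hLe1, mul_zero]
    | of_mul i α ih =>
      intro β
      induction β using FreeMonoid.inductionOn' with
      | one =>
        rw [wordProd_one, wordProd_of_mul, if_neg (of_mul_ne_one i α)]
        simp only [one_apply_eq_self, mul_apply_eq_comp]
        rw [hAw, inner_smul_right, ← inner_conj_symm, hLe1, map_zero, mul_zero]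
      | of_mul j β _ =>
        rw [wordProd_of_mul, wordProd_of_mul]
        simp only [mul_apply_eq_comp]
        rw [hT, ih, of_mul_inj]
        by_cases h : i = j <;> simp [h]
  have hon : Orthonormal ℂ (fun α : Word n => S (wordProd L α w)) := by
    rw [orthonormal_iff_ite]
    intro α β
    rw [hsymm, ← hAS, horth]
  have hdec : ∀ y, inner ℂ (e 1) y = 0 → y = ∑ i, L i (adjoint (L i) y) := by
    intro y hy
    rw [← sub_eq_zero]
    refine hb_zero e fun α => ?_
    rw [inner_sub_right, inner_sum]
    induction α using FreeMonoid.inductionOn' with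
    | one => simp [hLe1, hy]
    | of_mul j β _ =>
      rw [← hL]
      simp only [hLL]
      simp [adjoint_inner_right]
  have hcomp : ∀ (α : Word n) (y : F), (∀ β, inner ℂ (A (wordProd L β w)) y = 0) →
      inner ℂ (e α) y = 0 := by
    intro α
    induction α using FreeMonoid.inductionOn' with
    | one =>
      intro y hy
      have := hy 1
      rw [wordProd_one, one_apply_eq_self, hAw, inner_smul_left] at this
      exact (mul_eq_zero.1 this).resolve_left (by simpa using hc0)
    | of_mul i α ih =>
      intro y hy
      rw [← hL, ← adjoint_inner_right]
      refine ih _ fun β => ?_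
      have h1 : inner ℂ (e 1) y = 0 := by
        have := hy 1
        rw [wordProd_one, one_apply_eq_self, hAw, inner_smul_left] at this
        exact (mul_eq_zero.1 this).resolve_left (by simpa using hc0)
      have h2 := hy (FreeMonoid.of i * β)
      rw [hdec y h1, inner_sum, wordProd_of_mul] at h2
      simp only [mul_apply_eq_comp, hAsymm, hT] at h2
      simpa [hAsymm] using h2
  have hbot : (Submodule.span ℂ (Set.range fun α : Word n => S (wordProd L α w)))ᗮ = ⊥ := by
    rw [Submodule.eq_bot_iff]
    intro x hx
    have hx' : ∀ α, inner ℂ (S (wordProd L α w)) x = 0 := fun α =>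
      (Submodule.mem_orthogonal _ _).1 hx _ (Submodule.subset_span ⟨α, rfl⟩)
    have hz : B (S x) = 0 := by
      refine hb_zero e fun α => hcomp α _ fun β => ?_
      rw [hAsymm, hAB', ← hsymm, hx']
    have : S x = 0 := by rw [← hAB' (S x), hz, map_zero]
    rw [← hBS x, this]; simp
  let g := HilbertBasis.mkOfOrthogonalEqBot hon hbot
  have hg : ∀ α, g α = S (wordProd L α w) := fun α => by
    simp [g]
  obtain ⟨V, hV, hVi⟩ := hb_isom g (v := fun α => e (rev α))
    (e.orthonormal.comp rev (fun a b h => by rw [← rev_rev a, h, rev_rev]))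
  have hcomm : ∀ i x, R i (V (S x)) = V (S (L i x)) := by
    intro i
    have : R i * V = V * S * L i * B * S := by
      refine hb_ext g fun α => ?_
      simp only [mul_apply_eq_comp]
      rw [hV, hR, hg, hBS]
      have : L i (wordProd L α w) = wordProd L (FreeMonoid.of i * α) w := by
        rw [wordProd_of_mul]; rfl
      rw [this, ← hg, hV, rev_of_mul]
    intro x
    have := congrArg (fun T : F →L[ℂ] F => T (S x)) this
    simp only [mul_apply_eq_comp] at this
    rw [this, hBS]
  refine ⟨V (S (e 1)), fun γ => ?_⟩
  have : wordProd R γ (V (S (e 1))) = V (S (e γ)) := by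
    induction γ using FreeMonoid.inductionOn' with
    | one => simp [wordProd_one]
    | of_mul i γ ih =>
      rw [wordProd_of_mul, mul_apply_eq_comp, ih, hcomm, hL]
  rw [this, hVi, hsymm, hAS]

lemma cuntz {n : ℕ} (e : HilbertBasis (Word n) ℂ F) (T : Fin n → F →L[ℂ] F)
    (φ : Fin n → Word n → Word n) (hφ : ∀ i j α β, φ i α = φ j β ↔ i = j ∧ α = β)
    (hT : ∀ i α, T i (e α) = e (φ i α)) (i j : Fin n) :
    adjoint (T i) * T j = if i = j then 1 else 0 := by
  classical
  refine hb_ext e fun β => ?_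
  rw [← sub_eq_zero]
  refine hb_zero e fun α => ?_
  have ho := orthonormal_iff_ite.1 e.orthonormal
  rw [inner_sub_right, mul_apply_eq_comp, adjoint_inner_right, hT, hT, ho]
  by_cases h : i = j
  · subst h
    simp [hφ, ho]
  · simp [hφ, h]

lemma cuntz_inner {n : ℕ} {T : Fin n → F →L[ℂ] F}
    (hT : ∀ i j, adjoint (T i) * T j = if i = j then 1 else 0) (i j : Fin n) (x y : F) :
    inner ℂ (T i x) (T j y) = if i = j then inner ℂ x y else 0 := by
  rw [← adjoint_inner_right, ← mul_apply_eq_comp, hT]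
  by_cases h : i = j <;> simp [h]

lemma wordProd_inner {n : ℕ} {T : Fin n → F →L[ℂ] F}
    (hT : ∀ i j, adjoint (T i) * T j = if i = j then 1 else 0) (x : F) :
    ∀ α β : Word n, wordLen α = wordLen β → α ≠ β →
    inner ℂ (wordProd T α x) (wordProd T β x) = 0 := by
  intro α
  induction α using FreeMonoid.inductionOn' with
  | one =>
    intro β h hne
    exact absurd (List.length_eq_zero_iff.1 h.symm).symm hne
  | of_mul i α ih =>
    intro β
    induction β using FreeMonoid.inductionOn' with
    | one => intro h; exact absurd h (by simp [wordLen])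
    | of_mul j β _ =>
      intro h hne
      rw [wordProd_of_mul, wordProd_of_mul, mul_apply_eq_comp, mul_apply_eq_comp, cuntz_inner hT]
      by_cases hij : i = j
      · subst hij
        rw [if_pos rfl]
        refine ih β (by simpa [wordLen] using h) fun h' => hne (by rw [h'])
      · rw [if_neg hij]

lemma wordProd_norm {n : ℕ} {T : Fin n → F →L[ℂ] F}
    (hT : ∀ i j, adjoint (T i) * T j = if i = j then 1 else 0) (x : F) (α : Word n) :
    inner ℂ (wordProd T α x) (wordProd T α x) = inner ℂ x x := by
  induction α using FreeMonoid.inductionOn' with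
  | one => simp [wordProd_one]
  | of_mul i α ih =>
    rw [wordProd_of_mul, mul_apply_eq_comp, cuntz_inner hT, if_pos rfl, ih]

lemma wordLen_word {n k : ℕ} (f : Fin k → Fin n) : wordLen (word f) = k := by
  simp [wordLen, word]

lemma word_inj {n k : ℕ} {f g : Fin k → Fin n} (h : word f = word g) : f = g :=
  List.ofFn_injective h

lemma exists_word {n : ℕ} (α : Word n) : ∃ f : Fin (wordLen α) → Fin n, word f = α :=
  ⟨fun i => (FreeMonoid.toList α).get i, List.ofFn_get _⟩

lemma norm_sq_of_inner {x : F} {t : ℝ} (h : inner ℂ x x = (t : ℂ)) : ‖x‖ ^ 2 = t := by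
  have h1 := inner_self_eq_norm_sq (𝕜 := ℂ) x
  rw [h] at h1
  rw [← h1]
  rfl

lemma truncSum_norm {n : ℕ} {T : Fin n → F →L[ℂ] F}
    (hT : ∀ i j, adjoint (T i) * T j = if i = j then 1 else 0) (a : Word n → ℂ) (k : ℕ) :
    ‖truncSum a T k‖ ≤ Real.sqrt (∑ f : Fin k → Fin n, ‖a (word f)‖ ^ 2) := by
  refine ContinuousLinearMap.opNorm_le_bound _ (Real.sqrt_nonneg _) fun x => ?_
  refine le_of_sq_le_sq ?_ (by positivity) 
  rw [mul_pow, Real.sq_sqrt (by positivity)]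
  have : inner ℂ (truncSum a T k x) (truncSum a T k x)
      = (((∑ f : Fin k → Fin n, ‖a (word f)‖ ^ 2) * ‖x‖ ^ 2 : ℝ) : ℂ) := by
    simp only [truncSum, _root_.sum_apply, _root_.smul_apply]
    rw [sum_inner, Finset.sum_mul]
    push_cast
    refine Finset.sum_congr rfl fun f _ => ?_
    rw [inner_sum, Finset.sum_eq_single f]
    · rw [inner_smul_left, inner_smul_right, wordProd_norm hT, inner_self_eq_norm_sq_to_K,
        ← mul_assoc, Complex.conj_mul']
      rfl
    · intro g _ hg
      rw [inner_smul_left, inner_smul_right, wordProd_inner hT, mul_zero, mul_zero]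
      · rw [wordLen_word, wordLen_word]
      · exact fun h => hg (word_inj h).symm
    · simp
  exact le_of_eq (norm_sq_of_inner this)

lemma wordProd_smul {n : ℕ} (c : ℂ) (T : Fin n → F →L[ℂ] F) (α : Word n) :
    wordProd (fun i => c • T i) α = c ^ wordLen α • wordProd T α := by
  induction α using FreeMonoid.inductionOn' with
  | one => simp [wordProd_one, wordLen]
  | of_mul i α ih =>
    rw [wordProd_of_mul, wordProd_of_mul, ih]
    have : wordLen (FreeMonoid.of i * α) = wordLen α + 1 := by simp [wordLen]
    rw [this, smul_mul_smul_comm, pow_succ, mul_comm]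

lemma truncSum_smul {n : ℕ} (c : ℂ) (T : Fin n → F →L[ℂ] F) (a : Word n → ℂ) (k : ℕ) :
    truncSum a (fun i => c • T i) k = c ^ k • truncSum a T k := by
  simp only [truncSum, Finset.smul_sum, wordProd_smul, wordLen_word]
  refine Finset.sum_congr rfl fun f _ => ?_
  rw [smul_comm]

lemma truncSum_summable {n : ℕ} {T : Fin n → F →L[ℂ] F}
    (hT : ∀ i j, adjoint (T i) * T j = if i = j then 1 else 0) (a : Word n → ℂ)
    (ha : radCond 1 a) (r : ℝ) (h0 : 0 < r) (h1 : r < 1) :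
    Summable (fun k => truncSum a (fun i => (r : ℂ) • T i) k) := by
  obtain ⟨ρ, hρ1, hρr⟩ : ∃ ρ : ℝ, 1 < ρ ∧ ρ < 1 / r := exists_between (by
    rw [lt_div_iff₀ h0]; simpa using h1)
  have hlt : Filter.limsup
    (fun k : ℕ =>
      (∑ f : Fin k → Fin n, (‖a (word f)‖₊ : ℝ≥0∞) ^ 2) ^ ((1 : ℝ) / (2 * (k : ℝ))))
    Filter.atTop < ENNReal.ofReal ρ := by
    refine lt_of_le_of_lt ha ?_
    rw [ENNReal.ofReal_lt_ofReal_iff (by linarith)]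
    simpa using hρ1
  have hev := Filter.eventually_lt_of_limsup_lt hlt
  have hr : r * ρ < 1 := by rwa [lt_div_iff₀ h0, mul_comm] at hρr
  refine Summable.of_norm_bounded_eventually_nat
    (summable_geometric_of_lt_one (by positivity) hr) ?_
  filter_upwards [hev, Filter.eventually_ge_atTop 1] with k hk hk1
  rw [truncSum_smul, norm_smul, norm_pow, Complex.norm_real, Real.norm_of_nonneg h0.le, mul_pow]
  gcongr
  refine (truncSum_norm hT a k).trans ?_
  rw [Real.sqrt_le_left (by positivity)]
  have hk0 : (0 : ℝ) < 2 * k := by positivity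
  have h2 := ENNReal.rpow_lt_rpow hk hk0
  rw [← ENNReal.rpow_mul, one_div, inv_mul_cancel₀ hk0.ne', ENNReal.rpow_one] at h2
  have h3 : (∑ f : Fin k → Fin n, (‖a (word f)‖₊ : ℝ≥0∞) ^ 2)
      = ENNReal.ofReal (∑ f : Fin k → Fin n, ‖a (word f)‖ ^ 2) := by
    rw [ENNReal.ofReal_sum_of_nonneg (fun _ _ => by positivity)]
    refine Finset.sum_congr rfl fun f _ => ?_
    rw [ENNReal.ofReal_pow (norm_nonneg _), ofReal_norm]; rfl
  rw [h3, ENNReal.ofReal_rpow_of_pos (by linarith)] at h2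
  have h4 := (ENNReal.ofReal_lt_ofReal_iff (by positivity)).1 h2
  refine h4.le.trans (le_of_eq ?_)
  rw [← pow_mul, ← Real.rpow_natCast]
  push_cast
  rw [mul_comm]

lemma wordProd_basis {n : ℕ} (e : HilbertBasis (Word n) ℂ F)
    (R : Fin n → F →L[ℂ] F)
    (hR : ∀ (i : Fin n) (α : Word n), R i (e α) = e (α * FreeMonoid.of i)) (α β : Word n) :
    wordProd R α (e β) = e (β * rev α) := by
  induction α using FreeMonoid.inductionOn' with
  | one => simp [wordProd_one, rev_one]
  | of_mul i α ih => rw [wordProd_of_mul, mul_apply_eq_comp, ih, hR, rev_of_mul, mul_assoc]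

lemma wordLen_rev {n : ℕ} (α : Word n) : wordLen (rev α) = wordLen α := by
  simp [wordLen, rev]

lemma coef_one {n : ℕ} (e : HilbertBasis (Word n) ℂ F)
    (R : Fin n → F →L[ℂ] F)
    (hR : ∀ (i : Fin n) (α : Word n), R i (e α) = e (α * FreeMonoid.of i))
    (a : Word n → ℂ) (γ : Word n) (k : ℕ) :
    inner ℂ (e γ) (truncSum a R k (e 1)) = if k = wordLen γ then a (rev γ) else 0 := by
  classical
  have ho := orthonormal_iff_ite.1 e.orthonormal
  simp only [truncSum, _root_.sum_apply, _root_.smul_apply, inner_sum,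
    inner_smul_right, wordProd_basis e R hR, one_mul, ho]
  split_ifs with h
  · subst h
    obtain ⟨f, hf⟩ : ∃ f : Fin (wordLen γ) → Fin n, word f = rev γ := by
      have := exists_word (rev γ)
      rwa [wordLen_rev] at this
    rw [Finset.sum_eq_single f]
    · rw [hf, rev_rev, if_pos rfl, mul_one]
    · intro g _ hg
      rw [if_neg, mul_zero]
      intro h
      refine hg (word_inj ?_)
      rw [hf, ← rev_rev (word g)]
      exact congrArg rev h.symm
    · simp
  · refine Finset.sum_eq_zero fun f _ => ?_
    rw [if_neg, mul_zero]
    rintro rfl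
    exact h (by rw [wordLen_rev, wordLen_word])

lemma coef_two {n : ℕ} (e : HilbertBasis (Word n) ℂ F)
    (R : Fin n → F →L[ℂ] F)
    (hR : ∀ (i : Fin n) (α : Word n), R i (e α) = e (α * FreeMonoid.of i))
    (a : Word n → ℂ) (γ : Word n) (hγ : γ ≠ 1) (k : ℕ) :
    inner ℂ (e 1) (truncSum a R k (e γ)) = 0 := by
  classical
  have ho := orthonormal_iff_ite.1 e.orthonormal
  simp only [truncSum, _root_.sum_apply, _root_.smul_apply, inner_sum,
    inner_smul_right, wordProd_basis e R hR, ho]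
  refine Finset.sum_eq_zero fun f _ => ?_
  rw [if_neg, mul_zero]
  intro h
  exact hγ (List.append_eq_nil_iff.1 h.symm).1

lemma step {n : ℕ} (e : HilbertBasis (Word n) ℂ F)
    (R : Fin n → F →L[ℂ] F)
    (hR : ∀ (i : Fin n) (α : Word n), R i (e α) = e (α * FreeMonoid.of i))
    (a : Word n → ℂ) (ha : radCond 1 a)
    (hpos : ∀ X : Fin n → F →L[ℂ] F, inBall 1 X → (holOp a X + adjoint (holOp a X)).IsPositive)
    (r ε : ℝ) (h0 : 0 < r) (h1 : r < 1) (hε : 0 < ε) :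
    ∃ ξ : F, inner ℂ ξ ξ = (((a 1).re + ε : ℝ) : ℂ) ∧
      ∀ γ, γ ≠ 1 → inner ℂ (wordProd R γ ξ) ξ = (r : ℂ) ^ wordLen γ * a (rev γ) / 2 := by
  classical
  have ho := orthonormal_iff_ite.1 e.orthonormal
  have hRR : ∀ i j, adjoint (R i) * R j = if i = j then 1 else 0 :=
    cuntz e R (fun i α => α * FreeMonoid.of i) (fun i j α β => by
      constructor
      · intro h
        have h' := congrArg rev h
        have hr : ∀ (i : Fin n) (α : Word n), rev (α * FreeMonoid.of i) = FreeMonoid.of i * rev α :=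
          fun i α => by rw [← rev_rev (FreeMonoid.of i * rev α), rev_of_mul, rev_rev]
        rw [hr, hr, of_mul_inj] at h'
        exact ⟨h'.1, by rw [← rev_rev α, h'.2, rev_rev]⟩
      · rintro ⟨rfl, rfl⟩; rfl) hR
  have hLex : ∀ i : Fin n, ∃ V : F →L[ℂ] F, ∀ α, V (e α) = e (FreeMonoid.of i * α) := by
    intro i
    obtain ⟨V, hV, -⟩ := hb_isom e (v := fun α => e (FreeMonoid.of i * α))
      (e.orthonormal.comp (fun α => FreeMonoid.of i * α) (fun α β h => (of_mul_inj.1 h).2))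
    exact ⟨V, hV⟩
  choose L hL using hLex
  have hLs : ∀ i j, adjoint (L i) * L j = if i = j then 1 else 0 :=
    cuntz e L (fun i α => FreeMonoid.of i * α) (fun i j α β => of_mul_inj) hL
  have hLL := cuntz_inner hLs
  have hLR : ∀ i j, Commute (L i) (R j) := by
    intro i j
    refine hb_ext e fun α => ?_
    rw [mul_apply_eq_comp, mul_apply_eq_comp, hR, hL, hL, hR, mul_assoc]
  set X : Fin n → F →L[ℂ] F := fun i => (r : ℂ) • R i with hX
  have hball : inBall 1 X := by
    set Q := ∑ i, R i * adjoint (R i) with hQ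
    have hQs : star Q = Q := by
      simp [hQ, star_sum, ContinuousLinearMap.star_eq_adjoint]
      refine Finset.sum_congr rfl fun i _ => ?_
      rw [← ContinuousLinearMap.star_eq_adjoint, ← ContinuousLinearMap.star_eq_adjoint, star_mul, star_star]
    have hQQ : Q * Q = Q := by
      conv_lhs => rw [hQ, Finset.sum_mul_sum]
      refine Finset.sum_congr rfl fun i _ => ?_
      have : ∀ j, R i * adjoint (R i) * (R j * adjoint (R j))
          = if i = j then R i * adjoint (R j) else 0 := by
        intro j
        rw [mul_assoc, ← mul_assoc (adjoint (R i)), hRR]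
        by_cases h : i = j <;> simp [h]
      simp [this]
    have hQ1 : ‖Q‖ ≤ 1 := by
      have := CStarRing.norm_star_mul_self (x := Q)
      rw [hQs, hQQ] at this
      nlinarith [norm_nonneg Q]
    have hXQ : ∑ i, X i * adjoint (X i) = ((r : ℂ) ^ 2) • Q := by
      rw [hQ, Finset.smul_sum]
      refine Finset.sum_congr rfl fun i _ => ?_
      simp only [hX, ← ContinuousLinearMap.star_eq_adjoint, star_smul]
      rw [smul_mul_smul_comm]
      simp [pow_two]
    rw [inBall, hXQ, norm_smul, norm_pow, Complex.norm_real, Real.norm_of_nonneg h0.le]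
    nlinarith [norm_nonneg Q]
  have hsum := truncSum_summable hRR a ha r h0 h1
  rw [← hX] at hsum
  set f := holOp a X with hf
  have hfs : HasSum (fun k => truncSum a X k) f := hsum.hasSum
  have hLt : ∀ i k, Commute (L i) (truncSum a X k) := by
    intro i k
    rw [truncSum_smul]
    refine Commute.smul_right ?_ _
    refine Commute.sum_right _ _ _ fun g _ => Commute.smul_right ?_ _
    refine Commute.list_prod_right _ _ fun T hT => ?_
    obtain ⟨j, -, rfl⟩ := List.mem_map.1 hT
    exact hLR i j
  have hLf : ∀ i, L i * f = f * L i := by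
    intro i
    refine (hfs.mul_left (L i)).unique ?_
    have := hfs.mul_right (L i)
    simpa only [(hLt i _).eq] using this
  have hLfx : ∀ i x, f (L i x) = L i (f x) := fun i x => by
    rw [← mul_apply_eq_comp, ← hLf, mul_apply_eq_comp]
  set A : F →L[ℂ] F := (1 / 2 : ℂ) • (f + adjoint f) + (ε : ℂ) • 1 with hA
  have hAx : ∀ x y, inner ℂ x (A y) = (1 / 2 : ℂ) * (inner ℂ x (f y) + inner ℂ (f x) y)
      + ε * inner ℂ x y := by
    intro x y
    simp [hA, adjoint_inner_right]
    ring
  have hApos : IsStrictlyPositive A := by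
    have hp : 0 ≤ f + adjoint f := (nonneg_iff_isPositive _).2 (hpos X hball)
    have h3 : IsStrictlyPositive ((ε : ℂ) • (1 : F →L[ℂ] F)) :=
      IsStrictlyPositive.smul (by exact_mod_cast hε) isStrictlyPositive_one
    refine h3.of_le ?_
    rw [hA]
    refine le_add_of_nonneg_left (smul_nonneg (by positivity) hp)
  have hcoef : ∀ x y : F, HasSum (fun k => (r : ℂ) ^ k * inner ℂ x (truncSum a R k y))
      (inner ℂ x (f y)) := by
    intro x y
    have h := (hfs.mapL (ContinuousLinearMap.apply ℂ F y)).mapL (innerSL ℂ x)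
    simp only [hX, truncSum_smul] at h
    simpa [inner_smul_right] using h
  have hc1 : ∀ γ, inner ℂ (e γ) (f (e 1)) = (r : ℂ) ^ wordLen γ * a (rev γ) := by
    intro γ
    have h := hcoef (e γ) (e 1)
    simp only [coef_one e R hR] at h
    refine h.unique ?_
    have := hasSum_single (f := fun k => (r : ℂ) ^ k * if k = wordLen γ then a (rev γ) else 0)
      (wordLen γ) (fun k hk => by simp [hk])
    simpa using this
  have hc2 : ∀ γ, γ ≠ 1 → inner ℂ (f (e γ)) (e 1) = 0 := by
    intro γ hγ
    have h := hcoef (e 1) (e γ)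
    simp only [coef_two e R hR a γ hγ, mul_zero] at h
    rw [← inner_conj_symm, h.unique hasSum_zero, map_zero]
  obtain ⟨ξ, hξ⟩ := outer e R hR L hL hLL A hApos (by
    intro i j x y
    rw [hAx, hAx, hLfx, hLfx, hLL, hLL, hLL]
    by_cases h : i = j <;> simp [h])
  refine ⟨ξ, ?_, fun γ hγ => ?_⟩
  · have h := hξ 1
    have h11 := hc1 1
    have hl : wordLen (1 : Word n) = 0 := rfl
    rw [hl, rev_one, pow_zero, one_mul] at h11
    rw [wordProd_one, one_apply_eq_self, hAx, ← inner_conj_symm (f (e 1)), h11, ho, if_pos rfl,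
      Complex.add_conj] at h
    rw [h]; push_cast; ring
  · rw [hξ, hAx, hc1, hc2 γ hγ, ho, if_neg hγ]; ring

end helpers

/-- Herglotz–Riesz-type representation: if a free holomorphic function has
positive real part on the unit ball, then there is a positive linear functional `μ` on the
Cuntz–Toeplitz algebra `C*(R₁, …, Rₙ)` (the norm closure of the star subalgebra generated by
the right creation operators) with `μ(I) = Re a_{g₀}` and `a_α = 2 μ(R_{α̃}*)` for
`|α| ≥ 1`. -/
theorem stmt_18 (n : ℕ) (hn : 1 ≤ n)
    (F : Type) [NormedAddCommGroup F] [InnerProductSpace ℂ F] [CompleteSpace F]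
    (e : HilbertBasis (Word n) ℂ F)
    (R : Fin n → F →L[ℂ] F)
    (hR : ∀ (i : Fin n) (α : Word n), R i (e α) = e (α * FreeMonoid.of i))
    (a : Word n → ℂ) (ha : radCond 1 a)
    (hpos : ∀ (K : Type) [NormedAddCommGroup K] [InnerProductSpace ℂ K] [CompleteSpace K]
      (X : Fin n → K →L[ℂ] K), inBall 1 X →
        (holOp a X + adjoint (holOp a X)).IsPositive) :
    ∃ μ : (F →L[ℂ] F) →ₗ[ℂ] ℂ,
      (∀ T : F →L[ℂ] F,
        T ∈ closure ((StarAlgebra.adjoin ℂ (Set.range R) :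
          StarSubalgebra ℂ (F →L[ℂ] F)) : Set (F →L[ℂ] F)) →
        T.IsPositive → 0 ≤ μ T) ∧
      μ 1 = ((a 1).re : ℂ) ∧
      (∀ α : Word n, 1 ≤ wordLen α →
        a α = 2 * μ (adjoint (wordProd R
          (FreeMonoid.ofList (FreeMonoid.toList α).reverse)))) := by
  have hr : ∀ k : ℕ, ∃ ξ : F, inner ℂ ξ ξ = (((a 1).re + 1 / ((k : ℝ) + 1) : ℝ) : ℂ) ∧
      ∀ γ, γ ≠ 1 → inner ℂ (wordProd R γ ξ) ξ
        = (((1 - 1 / ((k : ℝ) + 2) : ℝ)) : ℂ) ^ wordLen γ * a (rev γ) / 2 := by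
    intro k
    have hk : (0 : ℝ) ≤ k := Nat.cast_nonneg k
    refine step e R hR a ha (fun X hX => hpos F X hX) _ _ ?_ ?_ (by positivity)
    · rw [sub_pos, div_lt_one (by positivity)]; linarith
    · have : 0 < 1 / ((k : ℝ) + 2) := by positivity
      linarith
  choose ξ hξ1 hξ using hr
  let m : ℕ → (F →L[ℂ] F) →ₗ[ℂ] ℂ := fun k =>
    { toFun := fun T => inner ℂ (ξ k) (T (ξ k))
      map_add' := fun S T => by simp
      map_smul' := fun c T => by simp }
  have hm : ∀ k T, m k T = inner ℂ (ξ k) (T (ξ k)) := fun k T => rfl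
  have hnorm : ∀ k, ‖ξ k‖ ^ 2 = (a 1).re + 1 / ((k : ℝ) + 1) := by
    intro k
    exact norm_sq_of_inner (hξ1 k)
  obtain ⟨μ, hμ⟩ := exists_lim m (by
    intro T
    refine ⟨‖T‖ * ((a 1).re + 1), fun k => ?_⟩
    have hk1 : 1 / ((k : ℝ) + 1) ≤ 1 := by
      rw [div_le_one (by positivity)]
      have : (0 : ℝ) ≤ k := Nat.cast_nonneg k
      linarith
    calc ‖m k T‖ ≤ ‖ξ k‖ * ‖T (ξ k)‖ := norm_inner_le_norm _ _
      _ ≤ ‖ξ k‖ * (‖T‖ * ‖ξ k‖) := by gcongr; exact T.le_opNorm _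
      _ = ‖T‖ * ‖ξ k‖ ^ 2 := by ring
      _ ≤ _ := by rw [hnorm]; gcongr)
  have hle : (hyperfilter ℕ : Filter ℕ) ≤ atTop := by
    rw [← Nat.cofinite_eq_atTop]; exact hyperfilter_le_cofinite
  have hlim1 : Tendsto (fun k : ℕ => 1 / ((k : ℝ) + 1)) atTop (nhds 0) :=
    tendsto_one_div_add_atTop_nhds_zero_nat
  have hlim2 : Tendsto (fun k : ℕ => 1 / ((k : ℝ) + 2)) atTop (nhds 0) := by
    have := (tendsto_add_atTop_iff_nat 1).2 hlim1
    refine this.congr fun k => ?_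
    push_cast; ring
  refine ⟨μ, fun T _ hT => ?_, ?_, fun α hα => ?_⟩
  · refine ge_of_tendsto' (hμ T) fun k => ?_
    rw [hm]
    exact hT.inner_nonneg_right _
  · refine tendsto_nhds_unique (hμ 1) ?_
    refine Tendsto.mono_left ?_ hle
    simp only [hm, one_apply_eq_self, hξ1]
    have := (Complex.continuous_ofReal.tendsto _).comp (hlim1.const_add (a 1).re)
    simpa [Function.comp_def] using this
  · have hne : rev α ≠ 1 := by
      intro h
      have : wordLen (rev α) = 0 := by rw [h]; rfl
      rw [wordLen_rev] at this; omega
    have h1 : μ (adjoint (wordProd R (rev α))) = a α / 2 := by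
      refine tendsto_nhds_unique (hμ _) ?_
      refine Tendsto.mono_left ?_ hle
      simp only [hm, adjoint_inner_right, hξ _ _ hne, rev_rev]
      have h2 := (Complex.continuous_ofReal.tendsto _).comp (hlim2.const_sub 1)
      have h3 := ((h2.pow (wordLen (rev α))).mul_const (a α)).div_const 2
      simpa [Function.comp_def] using h3
    change a α = 2 * μ (adjoint (wordProd R (rev α)))
    rw [h1]; ring

end
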